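/- arXiv:1908.05125 — 9 statements merged into one kernel-verified Lean document; each statement's English description precedes it below -/
import Mathlib

section
/- Let γ > 0 and let Δ, θ̃ : ℕ → ℝ be sequences satisfying θ̃(k) = (1/(1 + Δ(k)²/γ))·θ̃(k−1) for all k ≥ 1, with θ̃(0) ≠ 0. Then θ̃(k) → 0 as k → ∞ if and only if the series ∑_{k=1}^{∞} Δ(k)² diverges (i.e., Δ ∉ ℓ₂). -/
open Filter Finset

theorem one_add_sum_le_prod_one_add_of_nonneg {ι : Type*} (s : Finset ι) {f : ι → ℝ}
    (hf : ∀ i, 0 ≤ f i) : 1 + ∑ i ∈ s, f i ≤ ∏ i ∈ s, (1 + f i) := by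
  classical
  induction s using Finset.induction_on with
  | empty => simp
  | insert a s ha ih =>
    rw [sum_insert ha, prod_insert ha]
    nlinarith [hf a, mul_nonneg (hf a) (sum_nonneg fun i (_ : i ∈ s) => hf i),
      mul_le_mul_of_nonneg_left ih (hf a)]

theorem tendsto_prod_one_add_atTop_iff {α ι : Type*} {l : Filter α} (s : α → Finset ι)
    {f : ι → ℝ} (hf : ∀ i, 0 ≤ f i) :
    Tendsto (fun a => ∏ i ∈ s a, (1 + f i)) l atTop ↔
      Tendsto (fun a => ∑ i ∈ s a, f i) l atTop := by
  refine ⟨fun h => ?_, fun h => ?_⟩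
  · exact Real.tendsto_exp_comp_atTop.1
      (tendsto_atTop_mono (fun a => Real.prod_one_add_le_exp_sum (s a) hf) h)
  · exact tendsto_atTop_mono (fun a => one_add_sum_le_prod_one_add_of_nonneg (s a) hf)
      (tendsto_atTop_add_const_left _ _ h)

theorem tendsto_const_div_nhds_zero_iff {α : Type*} {l : Filter α} {c : ℝ} (hc : c ≠ 0)
    {P : α → ℝ} (hP : ∀ a, 0 < P a) :
    Tendsto (fun a => c / P a) l (nhds 0) ↔ Tendsto P l atTop := by
  refine ⟨fun h => ?_, fun h => h.const_div_atTop c⟩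
  have hinv : Tendsto (fun a => (P a)⁻¹) l (nhds 0) := by
    simpa [div_eq_mul_inv, hc] using h.const_mul c⁻¹
  have hinv' : Tendsto (fun a => (P a)⁻¹) l (nhdsWithin 0 (Set.Ioi 0)) :=
    tendsto_nhdsWithin_iff.2 ⟨hinv, Eventually.of_forall fun a => inv_pos.2 (hP a)⟩
  simpa [Pi.inv_def] using hinv'.inv_tendsto_nhdsGT_zero

theorem eq_div_prod_of_recurrence {θ d : ℕ → ℝ}
    (h : ∀ k, 1 ≤ k → θ k = (1 / d k) * θ (k - 1)) (n : ℕ) :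
    θ n = θ 0 / ∏ k ∈ Finset.Icc 1 n, d k := by
  induction n with
  | zero => simp
  | succ n ih =>
    rw [h (n + 1) (by simp), prod_Icc_succ_top (by simp), Nat.add_sub_cancel, ih, mul_comm,
      div_mul_div_comm, mul_one]

/-- The discrete-time DREM parameter error converges to zero if and only if the series
`∑_{k=1}^∞ Δ(k)²` diverges, i.e. `Δ ∉ ℓ₂`. -/
theorem drem_dt_convergence_iff (γ : ℝ) (hγ : 0 < γ) (Δ θt : ℕ → ℝ)
    (hpee : ∀ k, 1 ≤ k → θt k = (1 / (1 + (Δ k) ^ 2 / γ)) * θt (k - 1))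
    (h0 : θt 0 ≠ 0) :
    Tendsto θt atTop (nhds 0) ↔
      Tendsto (fun n => ∑ k ∈ Finset.Icc 1 n, (Δ k) ^ 2) atTop atTop := by
  rw [funext (eq_div_prod_of_recurrence hpee),
    tendsto_const_div_nhds_zero_iff h0 fun n => prod_pos fun k _ => by positivity,
    tendsto_prod_one_add_atTop_iff _ fun k => by positivity]
  simp only [← sum_div]
  exact tendsto_div_const_atTop_of_pos hγ
end

section
/- Let γ > 0 and let Δ, θ̃ : ℕ → ℝ be sequences satisfying θ̃(k) = (1/(1 + Δ(k)²/γ))·θ̃(k−1) for all k ≥ 1. Assume Δ is persistently exciting, i.e., there exist α > 0 and an integer K ≥ 1 such that ∑_{j=k+1}^{k+K} Δ(j)² ≥ α for all k ≥ 0. Then the parameter error converges to zero exponentially: there exist C ≥ 1 and ρ ∈ (0,1) such that |θ̃(k)| ≤ C·ρ^k·|θ̃(0)| for all k ≥ 0 (in fact one may take C = 1 + α/γ and ρ = (1 + α/γ)^{−1/K}). -/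
open Finset

/-- Over a window of length `m` starting at `n`, the error contracts at least by the factor
`1 + ∑ Δ(j)² / γ`. -/
lemma abs_mul_one_add_sum_le {γ : ℝ} (hγ : 0 < γ) {Δ θt : ℕ → ℝ}
    (h : ∀ k, 1 ≤ k → θt k = (1 / (1 + (Δ k) ^ 2 / γ)) * θt (k - 1)) (n m : ℕ) :
    |θt (n + m)| * (1 + (∑ j ∈ Icc (n + 1) (n + m), (Δ j) ^ 2) / γ) ≤ |θt n| := by
  induction m with
  | zero => simp
  | succ m ih =>
    rw [← add_assoc, sum_Icc_succ_top (by omega), add_div]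
    set S := (∑ j ∈ Icc (n + 1) (n + m), (Δ j) ^ 2) / γ
    set a := (Δ (n + m + 1)) ^ 2 / γ with ha
    have hS : 0 ≤ S := div_nonneg (sum_nonneg fun _ _ => sq_nonneg _) hγ.le
    have ha0 : 0 ≤ a := by positivity
    have hstep : |θt (n + m + 1)| * (1 + a) = |θt (n + m)| := by
      rw [h (n + m + 1) (by omega), ← ha, abs_mul, abs_of_pos (by positivity : 0 < 1 / (1 + a)),
        Nat.add_sub_cancel]
      field_simp
    calc |θt (n + m + 1)| * (1 + (S + a))
        ≤ |θt (n + m + 1)| * ((1 + a) * (1 + S)) := by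
          gcongr
          nlinarith [mul_nonneg ha0 hS]
      _ = |θt (n + m)| * (1 + S) := by rw [← mul_assoc, hstep]
      _ ≤ |θt n| := ih

/-- A sequence bounded by its initial value that shrinks by the factor `ρ ^ K` over every `K` steps
decays like `ρ ^ k`. -/
lemma le_inv_pow_mul_pow_mul {u : ℕ → ℝ} {ρ : ℝ} {K : ℕ} (hK : 1 ≤ K) (hρ : 0 < ρ) (hρ1 : ρ ≤ 1)
    (hu0 : 0 ≤ u 0) (hle : ∀ k, u k ≤ u 0) (hu : ∀ k, u (k + K) ≤ ρ ^ K * u k) (k : ℕ) :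
    u k ≤ (ρ ^ K)⁻¹ * ρ ^ k * u 0 := by
  induction k using Nat.strong_induction_on with
  | _ k ih =>
    rcases lt_or_ge k K with hk | hk
    · have h1 : 1 ≤ (ρ ^ K)⁻¹ * ρ ^ k := by
        rw [inv_mul_eq_div, one_le_div (by positivity)]
        exact pow_le_pow_of_le_one hρ.le hρ1 hk.le
      exact (hle k).trans (le_mul_of_one_le_left hu0 h1)
    · obtain ⟨m, rfl⟩ := Nat.exists_eq_add_of_le' hk
      calc u (m + K) ≤ ρ ^ K * u m := hu m
        _ ≤ ρ ^ K * ((ρ ^ K)⁻¹ * ρ ^ m * u 0) := by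
          gcongr
          exact ih m (by omega)
        _ = (ρ ^ K)⁻¹ * ρ ^ (m + K) * u 0 := by ring

/-- If the scalar regressor `Δ` is persistently exciting, the discrete-time DREM parameter
error converges to zero exponentially. -/
theorem drem_dt_exponential (γ : ℝ) (hγ : 0 < γ) (Δ θt : ℕ → ℝ)
    (hpee : ∀ k, 1 ≤ k → θt k = (1 / (1 + (Δ k) ^ 2 / γ)) * θt (k - 1))
    (α : ℝ) (hα : 0 < α) (K : ℕ) (hK : 1 ≤ K)
    (hPE : ∀ k : ℕ, α ≤ ∑ j ∈ Finset.Icc (k + 1) (k + K), (Δ j) ^ 2) :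
    ∃ C : ℝ, 1 ≤ C ∧ ∃ ρ : ℝ, ρ ∈ Set.Ioo (0 : ℝ) 1 ∧
      ∀ k : ℕ, |θt k| ≤ C * ρ ^ k * |θt 0| := by
  have hαγ : 0 < α / γ := by positivity
  set q := 1 + α / γ with hq
  have hq1 : 1 < q := by linarith
  have hq0 : 0 < q := by linarith
  set ρ : ℝ := q⁻¹ ^ ((K : ℝ)⁻¹) with hρ
  have hρK : ρ ^ K = q⁻¹ := Real.rpow_inv_natCast_pow (by positivity) (by omega)
  have hρ0 : 0 < ρ := Real.rpow_pos_of_pos (by positivity) _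
  have hKpos : (0 : ℝ) < (K : ℝ)⁻¹ := inv_pos.mpr (by exact_mod_cast hK)
  have hρ1 : ρ < 1 := Real.rpow_lt_one (by positivity) (inv_lt_one_of_one_lt₀ hq1) hKpos
  refine ⟨q, hq1.le, ρ, ⟨hρ0, hρ1⟩, fun k => ?_⟩
  have hle (k : ℕ) : |θt k| ≤ |θt 0| := by
    have h := abs_mul_one_add_sum_le hγ hpee 0 k
    rw [zero_add] at h
    refine le_trans (le_mul_of_one_le_right (abs_nonneg _) ?_) h
    exact le_add_of_nonneg_right (div_nonneg (sum_nonneg fun _ _ => sq_nonneg _) hγ.le)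
  have hcontr (k : ℕ) : |θt (k + K)| ≤ ρ ^ K * |θt k| := by
    rw [hρK, inv_mul_eq_div, le_div_iff₀ hq0]
    refine le_trans ?_ (abs_mul_one_add_sum_le hγ hpee k K)
    rw [hq]
    gcongr
    exact hPE k
  simpa only [hρK, inv_inv] using
    le_inv_pow_mul_pow_mul (u := fun k => |θt k|) hK hρ0 hρ1.le (abs_nonneg _) hle hcontr k
end

section
/- Let φ : ℕ → ℝ^m be a bounded sequence that is persistently exciting: there exist α > 0 and an integer K ≥ 1 (with K ≥ m) such that ∑_{j=k+1}^{k+K} φ(j)·φ(j)ᵀ ⪰ α·I_m for all k ≥ 0. Fix an integer K̄ ≥ K and define the extended regressor matrix Φ(k) := ∑_{j=k+1}^{k+K̄} φ(j)·φ(j)ᵀ and Δ(k) := det(Φ(k)). Then Δ(k) ≥ α^m for all k ≥ 0, and consequently ∑_{k=0}^{∞} Δ(k)² = ∞ (i.e., Δ ∉ ℓ₂). -/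
open Finset Filter Matrix

/-- If `α • 1 ≤ A` in the Loewner order, with `0 ≤ α`, then `α ^ card n ≤ det A`. -/
theorem pow_card_le_det_of_posSemidef_sub_smul_one {n : Type*} [Fintype n] [DecidableEq n]
    {A : Matrix n n ℝ} {α : ℝ} (hα : 0 ≤ α) (h : (A - α • (1 : Matrix n n ℝ)).PosSemidef) :
    α ^ Fintype.card n ≤ A.det := by
  have hA : A.IsHermitian := by
    have hsmul : (α • (1 : Matrix n n ℝ)).IsHermitian :=
      IsSelfAdjoint.smul (star_trivial α) isHermitian_one
    rw [← sub_add_cancel A (α • 1)]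
    exact h.isHermitian.add hsmul
  have hev (i : n) : α ≤ hA.eigenvalues i := by
    set v : n → ℝ := ⇑(hA.eigenvectorBasis i)
    have hpos := h.dotProduct_mulVec_nonneg v
    have hmul : A *ᵥ v = hA.eigenvalues i • v := hA.mulVec_eigenvectorBasis i
    have hne : v ≠ 0 := fun h0 =>
      hA.eigenvectorBasis.orthonormal.ne_zero i (by ext j; simpa using congrFun h0 j)
    have hvv : 0 < v ⬝ᵥ v := by simpa using dotProduct_star_self_pos_iff.mpr hne
    rw [sub_mulVec, hmul, smul_mulVec, one_mulVec, ← sub_smul, dotProduct_smul, star_trivial,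
      smul_eq_mul] at hpos
    linarith [nonneg_of_mul_nonneg_left hpos hvv]
  rw [hA.det_eq_prod_eigenvalues, ← Finset.card_univ, ← Finset.prod_const]
  exact Finset.prod_le_prod (fun _ _ => hα) fun i _ => hev i

/-- If the regressor `φ` is persistently exciting, then the determinant `Δ` of the
extended regressor matrix `Φ(k) = ∑_{j=k+1}^{k+K̄} φ(j) φ(j)ᵀ` is bounded below by `α^m`,
and hence `Δ ∉ ℓ₂`. -/
theorem drem_det_not_l2_of_pe {m : ℕ} (hm : 1 ≤ m) (φ : ℕ → Fin m → ℝ)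
    (M : ℝ) (hbdd : ∀ k, Real.sqrt (∑ i, (φ k i) ^ 2) ≤ M)
    (α : ℝ) (hα : 0 < α) (K : ℕ) (hK : 1 ≤ K) (hKm : m ≤ K)
    (hPE : ∀ k : ℕ,
      ((∑ j ∈ Finset.Icc (k + 1) (k + K), vecMulVec (φ j) (φ j)) -
        α • (1 : Matrix (Fin m) (Fin m) ℝ)).PosSemidef)
    (Kbar : ℕ) (hKbar : K ≤ Kbar)
    (Φ : ℕ → Matrix (Fin m) (Fin m) ℝ)
    (hΦ : ∀ k, Φ k = ∑ j ∈ Finset.Icc (k + 1) (k + Kbar), vecMulVec (φ j) (φ j))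
    (Δ : ℕ → ℝ) (hΔ : ∀ k, Δ k = (Φ k).det) :
    (∀ k : ℕ, α ^ m ≤ Δ k) ∧
      Tendsto (fun n => ∑ k ∈ Finset.range n, (Δ k) ^ 2) atTop atTop := by
  have hdet (k : ℕ) : α ^ m ≤ Δ k := by
    have hsub : Icc (k + 1) (k + K) ⊆ Icc (k + 1) (k + Kbar) := Icc_subset_Icc le_rfl (by lia)
    have htail : (∑ j ∈ Icc (k + 1) (k + Kbar) \ Icc (k + 1) (k + K),
        vecMulVec (φ j) (φ j)).PosSemidef :=
      posSemidef_sum _ fun j _ => by simpa using posSemidef_vecMulVec_self_star (φ j)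
    have hPSD : (Φ k - α • (1 : Matrix (Fin m) (Fin m) ℝ)).PosSemidef := by
      rw [hΦ, ← sum_sdiff hsub, add_sub_assoc]
      exact htail.add (hPE k)
    simpa [hΔ] using pow_card_le_det_of_posSemidef_sub_smul_one hα.le hPSD
  refine ⟨hdet, ?_⟩
  have hc : 0 < (α ^ m) ^ 2 := by positivity
  refine tendsto_atTop_mono (fun n => ?_) (tendsto_natCast_atTop_atTop.atTop_mul_const hc)
  calc (n : ℝ) * (α ^ m) ^ 2 = ∑ _k ∈ range n, (α ^ m) ^ 2 := by simp
    _ ≤ ∑ k ∈ range n, Δ k ^ 2 :=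
      sum_le_sum fun k _ => pow_le_pow_left₀ (by positivity) (hdet k) 2
end

section
/- Consider the scalar sequence φ(k) := (k+1)^{−1/4} for k ∈ ℕ, and set Δ(k) := φ(k)² = (k+1)^{−1/2}. Then: (a) φ is not persistently exciting, i.e., for every α > 0 and every integer K ≥ 1 there exists k ≥ 0 such that ∑_{j=k+1}^{k+K} φ(j)² < α; and (b) ∑_{k=0}^{∞} Δ(k)² = ∑_{k=0}^{∞} (k+1)^{−1} = ∞, i.e., Δ ∉ ℓ₂. Hence the DREM convergence condition Δ ∉ ℓ₂ does not imply that the regressor φ is persistently exciting. -/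
open Finset Filter

/-- Sums of a null sequence over sliding windows of fixed length tend to zero. -/
theorem tendsto_sum_Icc_window {f : ℕ → ℝ} (hf : Tendsto f atTop (nhds 0)) (K : ℕ) :
    Tendsto (fun k => ∑ j ∈ Finset.Icc (k + 1) (k + K), f j) atTop (nhds 0) := by
  have hsum (k : ℕ) :
      ∑ j ∈ Finset.Icc (k + 1) (k + K), f j = ∑ i ∈ Finset.range K, f (k + (1 + i)) := by
    have hIcc : Finset.Icc (k + 1) (k + K) = Finset.Ico (k + 1) (k + K + 1) := by
      ext j
      simp only [Finset.mem_Icc, Finset.mem_Ico]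
      omega
    rw [hIcc, Finset.sum_Ico_eq_sum_range, show k + K + 1 - (k + 1) = K by omega]
    simp only [add_assoc]
  simp_rw [hsum]
  simpa using tendsto_finsetSum (Finset.range K)
    fun i _ => hf.comp (tendsto_add_atTop_nat (1 + i))

/-- The counterexample `φ(k) = (k+1)^{-1/4}`, `Δ(k) = φ(k)² = (k+1)^{-1/2}`:
(a) `φ` is not persistently exciting, yet (b) `∑ Δ(k)² = ∑ (k+1)⁻¹ = ∞`, i.e. `Δ ∉ ℓ₂`.
Hence `Δ ∉ ℓ₂` does not imply that `φ` is persistently exciting. -/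
theorem drem_not_l2_not_imp_pe :
    (∀ α : ℝ, 0 < α → ∀ K : ℕ, 1 ≤ K → ∃ k : ℕ,
      ∑ j ∈ Finset.Icc (k + 1) (k + K), ((((j : ℝ) + 1) ^ (-(1 / 4 : ℝ))) ^ 2) < α) ∧
    Tendsto (fun n => ∑ k ∈ Finset.range n, ((((k : ℝ) + 1) ^ (-(1 / 2 : ℝ))) ^ 2))
      atTop atTop := by
  constructor
  · intro α hα K _
    have hbase : Tendsto (fun j : ℕ => (j : ℝ) + 1) atTop atTop :=
      tendsto_atTop_add_const_right _ _ tendsto_natCast_atTop_atTop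
    have hφ : Tendsto (fun j : ℕ => (((j : ℝ) + 1) ^ (-(1 / 4 : ℝ))) ^ 2) atTop (nhds 0) := by
      simpa using ((tendsto_rpow_neg_atTop (by norm_num : (0 : ℝ) < 1 / 4)).comp hbase).pow 2
    exact ((tendsto_sum_Icc_window hφ K).eventually_lt_const hα).exists
  · have hsq (k : ℕ) : (((k : ℝ) + 1) ^ (-(1 / 2 : ℝ))) ^ 2 = 1 / ((k : ℝ) + 1) := by
      rw [← Real.rpow_mul_natCast (by positivity)]
      norm_num [Real.rpow_neg_one]
    simp_rw [hsq]
    exact Real.tendsto_sum_range_one_div_nat_succ_atTop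
end

section
/- Let φ : ℕ → ℝ^m with |φ(k)| ≤ M for all k and some M > 0. Fix an integer K̄ ≥ 1, define Φ(k) := ∑_{j=k+1}^{k+K̄} φ(j)·φ(j)ᵀ and Δ(k) := det(Φ(k)), and suppose there exists α > 0 such that Δ(k)² ≥ α for all k ≥ 0 (i.e., Δ is persistently exciting with window length 1). Then φ is persistently exciting with window length K̄: Φ(k) ⪰ β·I_m for all k ≥ 0, where β := √α / (K̄·M²)^{m−1} > 0. -/
open Finset Matrix

theorem Matrix.IsHermitian.posSemidef_sub_smul_one {n : Type*} [Fintype n] [DecidableEq n]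
    {A : Matrix n n ℝ} (hA : A.IsHermitian) {b : ℝ} (hb : ∀ i, b ≤ hA.eigenvalues i) :
    (A - b • (1 : Matrix n n ℝ)).PosSemidef := by
  have hB : (A - b • (1 : Matrix n n ℝ)).IsHermitian :=
    hA.sub (by simp [Matrix.IsHermitian])
  refine hB.posSemidef_iff_eigenvalues_nonneg.2 fun i => ?_
  have hmem := hB.eigenvalues_mem_spectrum_real i
  rw [← spectrum.add_mem_add_iff (s := b), Algebra.algebraMap_eq_smul_one,
    add_sub_cancel, hA.spectrum_real_eq_range_eigenvalues] at hmem
  obtain ⟨j, hj⟩ := hmem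
  have := hb j
  simp only [Pi.zero_apply]
  linarith

theorem Matrix.PosSemidef.eigenvalues_le_trace {n : Type*} [Fintype n] [DecidableEq n]
    {A : Matrix n n ℝ} (hA : A.PosSemidef) (i : n) : hA.1.eigenvalues i ≤ A.trace := by
  rw [hA.1.trace_eq_sum_eigenvalues]
  exact Finset.single_le_sum (f := hA.1.eigenvalues) (fun j _ => hA.eigenvalues_nonneg j)
    (Finset.mem_univ i)

theorem Matrix.PosSemidef.det_le_eigenvalue_mul_pow {n : Type*} [Fintype n] [DecidableEq n]
    {A : Matrix n n ℝ} (hA : A.PosSemidef) {c : ℝ} (hc : A.trace ≤ c) (i : n) :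
    A.det ≤ hA.1.eigenvalues i * c ^ (Fintype.card n - 1) := by
  rw [hA.1.det_eq_prod_eigenvalues, ← Finset.mul_prod_erase _ _ (Finset.mem_univ i)]
  refine mul_le_mul_of_nonneg_left ?_ (hA.eigenvalues_nonneg i)
  calc ∏ j ∈ Finset.univ.erase i, hA.1.eigenvalues j
      ≤ ∏ _j ∈ Finset.univ.erase i, c :=
        Finset.prod_le_prod (fun j _ => hA.eigenvalues_nonneg j)
          fun j _ => (hA.eigenvalues_le_trace j).trans hc
    _ = c ^ (Fintype.card n - 1) := by
        rw [Finset.prod_const, Finset.card_erase_of_mem (Finset.mem_univ i), Finset.card_univ]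

/-- If the determinant `Δ` of the extended regressor matrix is persistently exciting with
window length 1 (i.e. `Δ(k)² ≥ α > 0` for all `k`) and the regressor is bounded, then the
regressor `φ` is persistently exciting with window length `K̄`:
`Φ(k) ⪰ β • I` with `β = √α / (K̄ M²)^{m-1}`. -/
theorem pe_of_drem_det_pe {m : ℕ} (hm : 1 ≤ m) (φ : ℕ → Fin m → ℝ)
    (M : ℝ) (hM : 0 < M) (hbdd : ∀ k, Real.sqrt (∑ i, (φ k i) ^ 2) ≤ M)
    (Kbar : ℕ) (hKbar : 1 ≤ Kbar)
    (Φ : ℕ → Matrix (Fin m) (Fin m) ℝ)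
    (hΦ : ∀ k, Φ k = ∑ j ∈ Finset.Icc (k + 1) (k + Kbar), vecMulVec (φ j) (φ j))
    (Δ : ℕ → ℝ) (hΔ : ∀ k, Δ k = (Φ k).det)
    (α : ℝ) (hα : 0 < α) (hΔPE : ∀ k : ℕ, α ≤ (Δ k) ^ 2) :
    0 < Real.sqrt α / ((Kbar : ℝ) * M ^ 2) ^ (m - 1) ∧
      ∀ k : ℕ,
        (Φ k - (Real.sqrt α / ((Kbar : ℝ) * M ^ 2) ^ (m - 1)) •
          (1 : Matrix (Fin m) (Fin m) ℝ)).PosSemidef := by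
  have hc : 0 < (Kbar : ℝ) * M ^ 2 := by positivity
  refine ⟨by positivity, fun k => ?_⟩
  have hpsd : (Φ k).PosSemidef := by
    rw [hΦ]
    exact posSemidef_sum _ fun j _ => by simpa using posSemidef_vecMulVec_self_star (φ j)
  have htr : (Φ k).trace ≤ Kbar * M ^ 2 := by
    rw [hΦ, trace_sum]
    calc ∑ j ∈ Finset.Icc (k + 1) (k + Kbar), (vecMulVec (φ j) (φ j)).trace
        ≤ ∑ _j ∈ Finset.Icc (k + 1) (k + Kbar), M ^ 2 := by
          refine Finset.sum_le_sum fun j _ => ?_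
          simpa [trace_vecMulVec, dotProduct, sq] using (Real.sqrt_le_left hM.le).1 (hbdd j)
      _ = Kbar * M ^ 2 := by simp
  refine hpsd.1.posSemidef_sub_smul_one fun i => ?_
  rw [div_le_iff₀ (by positivity)]
  have hdet : Real.sqrt α ≤ (Φ k).det :=
    (Real.sqrt_le_left hpsd.det_nonneg).2 (hΔ k ▸ hΔPE k)
  simpa using hdet.trans (hpsd.det_le_eigenvalue_mul_pow htr i)
end

section
/- Let γ > 0, let Δ : ℝ → ℝ be continuous, and let f : ℝ → ℝ be differentiable and satisfy f′(t) = −γ·Δ(t)²·f(t) for all t ≥ 0, with f(0) ≠ 0. Then f(t) → 0 as t → ∞ if and only if ∫₀ᵗ Δ(s)² ds → ∞ as t → ∞ (i.e., Δ ∉ L₂). -/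
open Filter

/-- The solution formula for the scalar linear ODE `f' = a f` on `[0, ∞)`. -/
theorem eq_exp_integral_mul_of_hasDerivAt {a f : ℝ → ℝ} (ha : Continuous a)
    (hf : ∀ t : ℝ, 0 ≤ t → HasDerivAt f (a t * f t) t) {t : ℝ} (ht : 0 ≤ t) :
    f t = Real.exp (∫ s in (0 : ℝ)..t, a s) * f 0 := by
  have hg : ∀ x : ℝ, 0 ≤ x →
      HasDerivAt (fun x => Real.exp (-∫ s in (0 : ℝ)..x, a s) * f x) 0 x := by
    intro x hx
    refine (((ha.integral_hasStrictDerivAt 0 x).hasDerivAt.neg.exp).mul (hf x hx)).congr_deriv ?_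
    ring
  have h := constant_of_has_deriv_right_zero (a := 0) (b := t)
    (fun x hx => (hg x hx.1).continuousAt.continuousWithinAt)
    (fun x hx => (hg x hx.1).hasDerivWithinAt) t ⟨ht, le_rfl⟩
  simp only [intervalIntegral.integral_same, neg_zero, Real.exp_zero, one_mul] at h
  rw [← h, ← mul_assoc, ← Real.exp_add, add_neg_cancel, Real.exp_zero, one_mul]

/-- The continuous-time DREM parameter error converges to zero if and only if
`∫₀ᵗ Δ(s)² ds → ∞`, i.e. `Δ ∉ L₂`. -/
theorem drem_ct_convergence_iff (γ : ℝ) (hγ : 0 < γ) (Δ f : ℝ → ℝ)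
    (hΔ : Continuous Δ)
    (hf : ∀ t : ℝ, 0 ≤ t → HasDerivAt f (-γ * (Δ t) ^ 2 * f t) t)
    (h0 : f 0 ≠ 0) :
    Tendsto f atTop (nhds 0) ↔
      Tendsto (fun t : ℝ => ∫ s in (0 : ℝ)..t, (Δ s) ^ 2) atTop atTop := by
  have hsol : f =ᶠ[atTop]
      fun t => Real.exp (-γ * ∫ s in (0 : ℝ)..t, (Δ s) ^ 2) * f 0 := by
    filter_upwards [eventually_ge_atTop 0] with t ht
    rw [← intervalIntegral.integral_const_mul]
    exact eq_exp_integral_mul_of_hasDerivAt (by fun_prop) hf ht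
  have hmul : Tendsto (fun t => Real.exp (-γ * ∫ s in (0 : ℝ)..t, (Δ s) ^ 2) * f 0)
      atTop (nhds 0) ↔
      Tendsto (fun t => Real.exp (-γ * ∫ s in (0 : ℝ)..t, (Δ s) ^ 2)) atTop (nhds 0) := by
    refine ⟨fun h => ?_, fun h => by simpa using h.mul_const (f 0)⟩
    simpa [h0] using h.mul_const (f 0)⁻¹
  rw [tendsto_congr' hsol, hmul, Real.tendsto_exp_comp_nhds_zero,
    tendsto_const_mul_atBot_of_neg (neg_neg_of_pos hγ)]
end

section
/- Let γ > 0, let Δ : ℝ → ℝ be continuous, and let f : ℝ → ℝ be differentiable and satisfy f′(t) = −γ·Δ(t)²·f(t) for all t ≥ 0. Assume Δ is persistently exciting: there exist T > 0 and α > 0 such that ∫_t^{t+T} Δ(s)² ds ≥ α for all t ≥ 0. Then f converges to zero exponentially; in fact |f(t)| ≤ e^{γα}·e^{−(γα/T)·t}·|f(0)| for all t ≥ 0. -/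
/-- Solutions of a scalar linear equation on `[0, ∞)` with continuous decay rate `a`. -/
theorem eq_exp_neg_integral_mul {a f : ℝ → ℝ} (ha : Continuous a)
    (hf : ∀ t : ℝ, 0 ≤ t → HasDerivAt f (-a t * f t) t) {t : ℝ} (ht : 0 ≤ t) :
    f t = Real.exp (-∫ s in (0 : ℝ)..t, a s) * f 0 := by
  have hder : ∀ x : ℝ, 0 ≤ x →
      HasDerivAt (fun x => f x * Real.exp (∫ s in (0 : ℝ)..x, a s)) 0 x := by
    intro x hx
    have h := (hf x hx).mul (ha.integral_hasStrictDerivAt 0 x).hasDerivAt.exp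
    exact h.congr_deriv (by ring)
  have hconst := constant_of_has_deriv_right_zero (a := 0) (b := t)
    (fun x hx => (hder x hx.1).continuousAt.continuousWithinAt)
    (fun x hx => (hder x hx.1).hasDerivWithinAt) t ⟨ht, le_rfl⟩
  simp only [intervalIntegral.integral_same, Real.exp_zero, mul_one] at hconst
  rw [← hconst, mul_left_comm, ← Real.exp_add, neg_add_cancel, Real.exp_zero, mul_one]

/-- Adding up the lower bound on consecutive windows of length `T`. -/
theorem natCast_mul_le_integral_of_window {g : ℝ → ℝ} (hg : Continuous g) {T α : ℝ}
    (hT : 0 ≤ T) (hwin : ∀ t : ℝ, 0 ≤ t → α ≤ ∫ s in t..(t + T), g s) (n : ℕ) :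
    n * α ≤ ∫ s in (0 : ℝ)..(n * T), g s := by
  induction n with
  | zero => simp
  | succ n ih =>
    have h := hwin (n * T) (by positivity)
    have hadd := intervalIntegral.integral_add_adjacent_intervals
      (hg.intervalIntegrable (μ := MeasureTheory.volume) 0 (n * T))
      (hg.intervalIntegrable (n * T) (n * T + T))
    have hsucc : ((n + 1 : ℕ) : ℝ) * T = n * T + T := by push_cast; ring
    rw [hsucc, ← hadd]
    push_cast
    linarith

/-- A nonnegative function with a lower bound on windows has linearly growing integral. -/
theorem div_sub_one_mul_le_integral_of_window {g : ℝ → ℝ} (hg : Continuous g)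
    (hg0 : ∀ s, 0 ≤ g s) {T α : ℝ} (hT : 0 < T) (hα : 0 ≤ α)
    (hwin : ∀ t : ℝ, 0 ≤ t → α ≤ ∫ s in t..(t + T), g s) {t : ℝ} (ht : 0 ≤ t) :
    (t / T - 1) * α ≤ ∫ s in (0 : ℝ)..t, g s := by
  have hfloor : (⌊t / T⌋₊ : ℝ) * T ≤ t :=
    (le_div_iff₀ hT).mp (Nat.floor_le (by positivity))
  calc (t / T - 1) * α ≤ ⌊t / T⌋₊ * α :=
        mul_le_mul_of_nonneg_right (Nat.sub_one_lt_floor _).le hα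
    _ ≤ ∫ s in (0 : ℝ)..(⌊t / T⌋₊ * T), g s :=
        natCast_mul_le_integral_of_window hg hT.le hwin _
    _ ≤ ∫ s in (0 : ℝ)..t, g s :=
        intervalIntegral.integral_mono_interval le_rfl (by positivity) hfloor
          (Filter.Eventually.of_forall hg0) (hg.intervalIntegrable _ _)

/-- If `Δ` is persistently exciting, the continuous-time DREM parameter error converges
to zero exponentially: `|f(t)| ≤ e^{γα} e^{-(γα/T) t} |f(0)|`. -/
theorem drem_ct_exponential (γ : ℝ) (hγ : 0 < γ) (Δ f : ℝ → ℝ)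
    (hΔ : Continuous Δ)
    (hf : ∀ t : ℝ, 0 ≤ t → HasDerivAt f (-γ * (Δ t) ^ 2 * f t) t)
    (T α : ℝ) (hT : 0 < T) (hα : 0 < α)
    (hPE : ∀ t : ℝ, 0 ≤ t → α ≤ ∫ s in t..(t + T), (Δ s) ^ 2) :
    ∀ t : ℝ, 0 ≤ t →
      |f t| ≤ Real.exp (γ * α) * Real.exp (-(γ * α / T) * t) * |f 0| := by
  intro t ht
  have hsol := eq_exp_neg_integral_mul (a := fun s => γ * (Δ s) ^ 2) (by fun_prop)
    (fun x hx => by simpa only [neg_mul] using hf x hx) ht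
  rw [intervalIntegral.integral_const_mul] at hsol
  have hint := mul_le_mul_of_nonneg_left (div_sub_one_mul_le_integral_of_window
    (hΔ.pow 2) (fun s => sq_nonneg (Δ s)) hT hα.le hPE ht) hγ.le
  have hexp : γ * ((t / T - 1) * α) = -(γ * α + -(γ * α / T) * t) := by ring
  rw [hsol, abs_mul, Real.abs_exp, ← Real.exp_add]
  gcongr
  simp only [Pi.pow_apply] at hint
  linarith
end

section
/- Let γ > 0, let Δ : ℝ → ℝ be continuous, let θ, θ̂₀ ∈ ℝ, and define w(t) := exp(−γ·∫₀ᵗ Δ(s)² ds) and θ̂(t) := θ + w(t)·(θ̂₀ − θ) (the solution of the DREM gradient estimator with initial estimate θ̂₀). Fix μ ∈ (0,1) and suppose there exists t_c > 0 such that γ·∫₀^{t_c} Δ(s)² ds ≥ −ln(μ). Then for all t ≥ t_c: w(t) ≤ μ < 1, and the finite-time estimate (θ̂(t) − w(t)·θ̂₀)/(1 − w(t)) equals θ exactly. -/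
/-- Finite-time-convergent DREM: under the interval excitation condition
`γ ∫₀^{t_c} Δ² ≥ -ln μ` with `μ ∈ (0,1)`, the weight `w(t) = exp(-γ ∫₀ᵗ Δ²)` satisfies
`w(t) ≤ μ < 1` for all `t ≥ t_c`, and the FTC estimate
`(θ̂(t) - w(t) θ̂₀)/(1 - w(t))` equals `θ` exactly. -/
theorem drem_ftc (γ : ℝ) (hγ : 0 < γ) (Δ : ℝ → ℝ) (hΔ : Continuous Δ)
    (θ θh0 : ℝ) (w θh : ℝ → ℝ)
    (hw : ∀ t, w t = Real.exp (-γ * ∫ s in (0 : ℝ)..t, (Δ s) ^ 2))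
    (hθh : ∀ t, θh t = θ + w t * (θh0 - θ))
    (μ : ℝ) (hμ : μ ∈ Set.Ioo (0 : ℝ) 1)
    (tc : ℝ) (htc : 0 < tc)
    (hexc : -Real.log μ ≤ γ * ∫ s in (0 : ℝ)..tc, (Δ s) ^ 2) :
    ∀ t : ℝ, tc ≤ t →
      w t ≤ μ ∧ μ < 1 ∧ (θh t - w t * θh0) / (1 - w t) = θ := by
  intro t ht
  have hmono : ∫ s in (0 : ℝ)..tc, (Δ s) ^ 2 ≤ ∫ s in (0 : ℝ)..t, (Δ s) ^ 2 :=
    intervalIntegral.integral_mono_interval le_rfl htc.le ht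
      (Filter.Eventually.of_forall fun s ↦ sq_nonneg (Δ s)) ((hΔ.pow 2).intervalIntegrable 0 t)
  have hwμ : w t ≤ μ := by
    rw [hw t, ← Real.le_log_iff_exp_le hμ.1]
    linarith [mul_le_mul_of_nonneg_left hmono hγ.le]
  refine ⟨hwμ, hμ.2, ?_⟩
  have hne : 1 - w t ≠ 0 := (sub_pos.2 (hwμ.trans_lt hμ.2)).ne'
  rw [hθh t, div_eq_iff hne]
  ring
end

section
/- Let γ > 0, T_D > 0, let Δ : ℝ → ℝ be continuous with Δ(s) = 0 for all s < 0, let θ, θ̂₀ ∈ ℝ, and define θ̂(t) := θ + exp(−γ·∫₀ᵗ Δ(s)² ds)·(θ̂₀ − θ) for t ≥ 0 (the solution of the DREM gradient estimator) and w^D(t) := exp(−γ·∫_{t−T_D}^t Δ(s)² ds). Then for all t ≥ T_D: (1 − w^D(t))·θ = θ̂(t) − w^D(t)·θ̂(t − T_D). Consequently, for any t ≥ T_D with ∫_{t−T_D}^t Δ(s)² ds > 0 one has w^D(t) < 1 and θ = (θ̂(t) − w^D(t)·θ̂(t − T_D))/(1 − w^D(t)). -/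
/-- Alertness-preserving FTC DREM: with the sliding-window weight
`w^D(t) = exp(-γ ∫_{t-T_D}^t Δ²)`, one has
`(1 - w^D(t)) θ = θ̂(t) - w^D(t) θ̂(t - T_D)` for all `t ≥ T_D`; whenever the window
carries excitation, `w^D(t) < 1` and `θ` is recovered exactly. -/
theorem drem_ftc_alert (γ TD : ℝ) (hγ : 0 < γ) (hTD : 0 < TD)
    (Δ : ℝ → ℝ) (hΔ : Continuous Δ) (hΔneg : ∀ s : ℝ, s < 0 → Δ s = 0)
    (θ θh0 : ℝ) (θh wD : ℝ → ℝ)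
    (hθh : ∀ t : ℝ, 0 ≤ t →
      θh t = θ + Real.exp (-γ * ∫ s in (0 : ℝ)..t, (Δ s) ^ 2) * (θh0 - θ))
    (hwD : ∀ t : ℝ, wD t = Real.exp (-γ * ∫ s in (t - TD)..t, (Δ s) ^ 2)) :
    ∀ t : ℝ, TD ≤ t →
      (1 - wD t) * θ = θh t - wD t * θh (t - TD) ∧
      (0 < ∫ s in (t - TD)..t, (Δ s) ^ 2 →
        wD t < 1 ∧ θ = (θh t - wD t * θh (t - TD)) / (1 - wD t)) := by
  intro t ht
  have hint : ∀ a b : ℝ, IntervalIntegrable (fun s => (Δ s) ^ 2) MeasureTheory.volume a b :=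
    fun a b => (hΔ.pow 2).intervalIntegrable a b
  have hsplit := intervalIntegral.integral_add_adjacent_intervals
    (hint 0 (t - TD)) (hint (t - TD) t)
  have hexp : Real.exp (-γ * ∫ s in (0 : ℝ)..t, (Δ s) ^ 2) =
      wD t * Real.exp (-γ * ∫ s in (0 : ℝ)..(t - TD), (Δ s) ^ 2) := by
    rw [hwD, ← Real.exp_add, ← hsplit]
    ring_nf
  have hid : (1 - wD t) * θ = θh t - wD t * θh (t - TD) := by
    rw [hθh t (hTD.le.trans ht), hθh (t - TD) (sub_nonneg.mpr ht), hexp]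
    ring
  refine ⟨hid, fun hexc => ?_⟩
  have hlt : wD t < 1 := by
    rw [hwD, Real.exp_lt_one_iff]
    exact mul_neg_of_neg_of_pos (neg_neg_of_pos hγ) hexc
  exact ⟨hlt, by rw [← hid, mul_div_cancel_left₀ θ (sub_pos.mpr hlt).ne']⟩
end
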